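/- Let 𝒢 be an arbitrary ultragraph, R a unital commutative ring, and F the free group on the set 𝒢¹. Then L_R(𝒢) is F-graded: there exists a family {L_t}_{t∈F} of R-submodules of L_R(𝒢) such that L_R(𝒢) = ⊕_{t∈F} L_t (internal direct sum), L_s · L_t ⊆ L_{st} for all s, t ∈ F, and p_A ∈ L_0 for every A ∈ 𝒢⁰, s_e ∈ L_e and s_e* ∈ L_{e⁻¹} for every e ∈ 𝒢¹ (where 0 denotes the identity of F and each edge e is regarded as a generator of F). -/

import Mathlib

universe u v w

/-- An ultragraph `𝒢 = (G⁰, 𝒢¹, r, s)`: a set of vertices `V`, a set of edges `E`,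
a source map `s : E → V` and a range map `r : E → P(V) ∖ {∅}`. -/
structure Ultragraph (V : Type u) (E : Type v) where
  s : E → V
  r : E → Set V
  r_nonempty : ∀ e, (r e).Nonempty

namespace Ultragraph

variable {V : Type u} {E : Type v}

/-- The collection `𝒢⁰` of generalized vertices: the smallest collection of subsets of `V`
containing all singletons and all ranges, closed under finite unions and intersections
(it contains the empty set). -/
inductive IsG0 (G : Ultragraph V E) : Set V → Prop
  | empty : IsG0 G ∅
  | singleton (v : V) : IsG0 G {v}
  | range (e : E) : IsG0 G (G.r e)
  | union {A B : Set V} : IsG0 G A → IsG0 G B → IsG0 G (A ∪ B)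
  | inter {A B : Set V} : IsG0 G A → IsG0 G B → IsG0 G (A ∩ B)

/-- `𝒢⁰` as a type. -/
def G0 (G : Ultragraph V E) : Type u := {A : Set V // G.IsG0 A}

def vtx (G : Ultragraph V E) (v : V) : G.G0 := ⟨{v}, IsG0.singleton v⟩

def rng (G : Ultragraph V E) (e : E) : G.G0 := ⟨G.r e, IsG0.range e⟩

def emptyG0 (G : Ultragraph V E) : G.G0 := ⟨∅, IsG0.empty⟩

def interG0 (G : Ultragraph V E) (A B : G.G0) : G.G0 := ⟨A.1 ∩ B.1, A.2.inter B.2⟩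

def unionG0 (G : Ultragraph V E) (A B : G.G0) : G.G0 := ⟨A.1 ∪ B.1, A.2.union B.2⟩

/-- Generators of the ultragraph Leavitt path algebra: edges `s_e`, ghost edges `s_e*`,
and projections `p_A` for `A ∈ 𝒢⁰`. -/
inductive LGen (G : Ultragraph V E) : Type max u v
  | edge (e : E) : LGen G
  | ghost (e : E) : LGen G
  | proj (A : G.G0) : LGen G

/-- The defining relations of the ultragraph Leavitt path algebra, as a relation on the
free `R`-algebra on the generators. -/
inductive LeavittRel (R : Type w) [CommRing R] (G : Ultragraph V E) :
    FreeAlgebra R (LGen G) → FreeAlgebra R (LGen G) → Prop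
  | p_empty :
      LeavittRel R G (FreeAlgebra.ι R (LGen.proj G.emptyG0)) 0
  | p_mul (A B : G.G0) :
      LeavittRel R G (FreeAlgebra.ι R (LGen.proj A) * FreeAlgebra.ι R (LGen.proj B))
        (FreeAlgebra.ι R (LGen.proj (G.interG0 A B)))
  | p_union (A B : G.G0) :
      LeavittRel R G (FreeAlgebra.ι R (LGen.proj (G.unionG0 A B)))
        (FreeAlgebra.ι R (LGen.proj A) + FreeAlgebra.ι R (LGen.proj B)
          - FreeAlgebra.ι R (LGen.proj (G.interG0 A B)))
  | src_edge (e : E) :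
      LeavittRel R G
        (FreeAlgebra.ι R (LGen.proj (G.vtx (G.s e))) * FreeAlgebra.ι R (LGen.edge e))
        (FreeAlgebra.ι R (LGen.edge e))
  | edge_rng (e : E) :
      LeavittRel R G
        (FreeAlgebra.ι R (LGen.edge e) * FreeAlgebra.ι R (LGen.proj (G.rng e)))
        (FreeAlgebra.ι R (LGen.edge e))
  | rng_ghost (e : E) :
      LeavittRel R G
        (FreeAlgebra.ι R (LGen.proj (G.rng e)) * FreeAlgebra.ι R (LGen.ghost e))
        (FreeAlgebra.ι R (LGen.ghost e))
  | ghost_src (e : E) :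
      LeavittRel R G
        (FreeAlgebra.ι R (LGen.ghost e) * FreeAlgebra.ι R (LGen.proj (G.vtx (G.s e))))
        (FreeAlgebra.ι R (LGen.ghost e))
  | ghost_edge_ne {e f : E} (h : e ≠ f) :
      LeavittRel R G (FreeAlgebra.ι R (LGen.ghost e) * FreeAlgebra.ι R (LGen.edge f)) 0
  | ghost_edge (e : E) :
      LeavittRel R G (FreeAlgebra.ι R (LGen.ghost e) * FreeAlgebra.ι R (LGen.edge e))
        (FreeAlgebra.ι R (LGen.proj (G.rng e)))
  | ck (v : V) (hfin : {e : E | G.s e = v}.Finite) (hne : {e : E | G.s e = v}.Nonempty) :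
      LeavittRel R G (FreeAlgebra.ι R (LGen.proj (G.vtx v)))
        (∑ e ∈ hfin.toFinset, FreeAlgebra.ι R (LGen.edge e) * FreeAlgebra.ι R (LGen.ghost e))

/-- The ultragraph Leavitt path algebra `L_R(𝒢)`. -/
def LeavittAlgebra (R : Type w) [CommRing R] (G : Ultragraph V E) : Type max u v w :=
  RingQuot (LeavittRel R G)

instance (R : Type w) [CommRing R] (G : Ultragraph V E) : Ring (LeavittAlgebra R G) :=
  inferInstanceAs (Ring (RingQuot (LeavittRel R G)))

instance (R : Type w) [CommRing R] (G : Ultragraph V E) : Algebra R (LeavittAlgebra R G) :=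
  inferInstanceAs (Algebra R (RingQuot (LeavittRel R G)))

/-- The projection `p_A ∈ L_R(𝒢)`, for `A ∈ 𝒢⁰`. -/
def Pg (G : Ultragraph V E) (R : Type w) [CommRing R] (A : G.G0) : LeavittAlgebra R G :=
  RingQuot.mkAlgHom R (LeavittRel R G) (FreeAlgebra.ι R (LGen.proj A))

/-- The element `s_e ∈ L_R(𝒢)`. -/
def Se (G : Ultragraph V E) (R : Type w) [CommRing R] (e : E) : LeavittAlgebra R G :=
  RingQuot.mkAlgHom R (LeavittRel R G) (FreeAlgebra.ι R (LGen.edge e))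

/-- The element `s_e* ∈ L_R(𝒢)`. -/
def St (G : Ultragraph V E) (R : Type w) [CommRing R] (e : E) : LeavittAlgebra R G :=
  RingQuot.mkAlgHom R (LeavittRel R G) (FreeAlgebra.ι R (LGen.ghost e))

/-- For a finite path `c = c₁ ⋯ c_k`, the element `s_c = s_{c₁} ⋯ s_{c_k}`
(the empty product for the empty list). -/
def Sp (G : Ultragraph V E) (R : Type w) [CommRing R] (c : List E) : LeavittAlgebra R G :=
  (c.map (G.Se R)).prod

/-- A (finite, nonempty) path in the ultragraph. -/
def IsPath (G : Ultragraph V E) (c : List E) : Prop :=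
  c ≠ [] ∧ c.Chain' (fun e f => G.s f ∈ G.r e)

/-- A closed path: a path with `s(c₁) ∈ r(c_k)`. -/
def IsClosedPath (G : Ultragraph V E) (c : List E) : Prop :=
  ∃ h : G.IsPath c, G.s (c.head h.1) ∈ G.r (c.getLast h.1)

/-- A cycle: a closed path whose edges have pairwise distinct sources. -/
def IsCycle (G : Ultragraph V E) (c : List E) : Prop :=
  G.IsClosedPath c ∧ c.Pairwise (fun e f => G.s e ≠ G.s f)

/-- A sink: a vertex emitting no edges. -/
def IsSink (G : Ultragraph V E) (v : V) : Prop := ∀ e, G.s e ≠ v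

/-- An exit for a closed path `c`: an edge `f` with `s(f) ∈ r(c_i)` and `f ≠ c_{i+1}`
(indices cyclic), or a sink in some `r(c_i)`. -/
def HasExit (G : Ultragraph V E) (c : List E) : Prop :=
  (∃ (f : E) (i : Fin c.length), G.s f ∈ G.r (c.get i) ∧
      f ≠ c.get ⟨(i.1 + 1) % c.length, Nat.mod_lt _ i.pos⟩) ∨
  (∃ (w : V) (i : Fin c.length), G.IsSink w ∧ w ∈ G.r (c.get i))

/-- Condition (L): every closed path has an exit. -/
def ConditionL (G : Ultragraph V E) : Prop :=
  ∀ c : List E, G.IsClosedPath c → G.HasExit c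

/-- The range `r(c)` of a finite path `c` (the range of its last edge). -/
def pathRange (G : Ultragraph V E) (c : List E) : Set V :=
  (c.getLast?.map G.r).getD ∅

theorem isG0_pathRange (G : Ultragraph V E) (c : List E) : G.IsG0 (G.pathRange c) := by
  unfold pathRange
  cases c.getLast? with
  | none => exact IsG0.empty
  | some e => exact IsG0.range e

/-- The range of a path, as an element of `𝒢⁰`. -/
def pathRng (G : Ultragraph V E) (c : List E) : G.G0 :=
  ⟨G.pathRange c, G.isG0_pathRange c⟩

end Ultragraph
namespace Ultragraph

open scoped Classical

variable {V : Type u} {E : Type v}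

/-- A `𝒢`-algebraic branching system on a set `X`. -/
structure BranchingSystem (G : Ultragraph V E) (X : Type*) where
  Re : E → Set X
  D : G.G0 → Set X
  disj : ∀ ⦃e f : E⦄, e ≠ f → Re e ∩ Re f = ∅
  D_empty : D G.emptyG0 = ∅
  D_inter : ∀ A B : G.G0, D A ∩ D B = D (G.interG0 A B)
  D_union : ∀ A B : G.G0, D A ∪ D B = D (G.unionG0 A B)
  Re_subset : ∀ e : E, Re e ⊆ D (G.vtx (G.s e))
  D_vtx : ∀ v : V, {e : E | G.s e = v}.Finite → {e : E | G.s e = v}.Nonempty →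
    D (G.vtx v) = ⋃ e ∈ {e : E | G.s e = v}, Re e
  fe : ∀ e : E, ↥(D (G.rng e)) ≃ ↥(Re e)

namespace BranchingSystem

variable {G : Ultragraph V E} {X : Type*}

/-- The extension of `f_e : D_{r(e)} → R_e` to a function `X → X` (identity elsewhere). -/
noncomputable def tot (B : BranchingSystem G X) (e : E) : X → X := fun x =>
  if h : x ∈ B.D (G.rng e) then (B.fe e ⟨x, h⟩ : X) else x

/-- For a path `c = c₁ ⋯ c_k`, the composite `f_c = f_{c₁} ∘ ⋯ ∘ f_{c_k}` (extended). -/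
noncomputable def pathMap (B : BranchingSystem G X) (c : List E) : X → X :=
  c.foldr (fun e g => B.tot e ∘ g) id

end BranchingSystem

/-- `π : L_R(𝒢) → Hom_R(M)`, with `M` the module of all functions `X → R`, is the
representation induced by the branching system `B` if it satisfies the defining formulas
`π(s_e)(φ) = (φ ∘ f_e⁻¹)·1_{R_e}`, `π(s_e*)(φ) = (φ ∘ f_e)·1_{D_{r(e)}}`,
`π(p_A)(φ) = 1_{D_A}·φ`. -/
def IsInducedRep (G : Ultragraph V E) (R : Type w) [CommRing R] {X : Type*}
    (B : BranchingSystem G X)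
    (π : LeavittAlgebra R G →ₐ[R] Module.End R (X → R)) : Prop :=
  (∀ (e : E) (φ : X → R) (x : X),
      π (G.Se R e) φ x = if h : x ∈ B.Re e then φ ((B.fe e).symm ⟨x, h⟩ : X) else 0) ∧
  (∀ (e : E) (φ : X → R) (x : X),
      π (G.St R e) φ x = if h : x ∈ B.D (G.rng e) then φ ((B.fe e ⟨x, h⟩ : X)) else 0) ∧
  (∀ (A : G.G0) (φ : X → R) (x : X),
      π (G.Pg R A) φ x = if x ∈ B.D A then φ x else 0)

/-- The analogue of `IsInducedRep` for the module of finitely supported functions `X →₀ R`. -/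
def IsInducedRepF (G : Ultragraph V E) (R : Type w) [CommRing R] {X : Type*}
    (B : BranchingSystem G X)
    (π : LeavittAlgebra R G →ₐ[R] Module.End R (X →₀ R)) : Prop :=
  (∀ (e : E) (φ : X →₀ R) (x : X),
      π (G.Se R e) φ x = if h : x ∈ B.Re e then φ ((B.fe e).symm ⟨x, h⟩ : X) else 0) ∧
  (∀ (e : E) (φ : X →₀ R) (x : X),
      π (G.St R e) φ x = if h : x ∈ B.D (G.rng e) then φ ((B.fe e ⟨x, h⟩ : X)) else 0) ∧
  (∀ (A : G.G0) (φ : X →₀ R) (x : X),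
      π (G.Pg R A) φ x = if x ∈ B.D A then φ x else 0)

section Representations

variable (G : Ultragraph V E) (R : Type w) [CommRing R]
variable {N : Type*} [AddCommGroup N] [Module R N]

/-- `S` is a basis of the submodule `W`: it is contained in `W`, linearly independent,
and spans `W`. -/
def IsBasisOf (S : Set N) (W : Submodule R N) : Prop :=
  S ⊆ (W : Set N) ∧ LinearIndependent R ((↑) : S → N) ∧ Submodule.span R S = W

/-- The submodule `N_v = π(p_v)(N)`. -/
def NvSub (π : LeavittAlgebra R G →ₐ[R] Module.End R N) (v : V) : Submodule R N :=
  LinearMap.range (π (G.Pg R (G.vtx v)))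

/-- The submodule `N_{r(e)} = π(p_{r(e)})(N)`. -/
def NreSub (π : LeavittAlgebra R G →ₐ[R] Module.End R N) (e : E) : Submodule R N :=
  LinearMap.range (π (G.Pg R (G.rng e)))

/-- The submodule `N_A = π(p_A)(N)`. -/
def NASub (π : LeavittAlgebra R G →ₐ[R] Module.End R N) (A : G.G0) : Submodule R N :=
  LinearMap.range (π (G.Pg R A))

/-- The submodule `N_e = π(s_e s_e*)(N)`. -/
def NeSub (π : LeavittAlgebra R G →ₐ[R] Module.End R N) (e : E) : Submodule R N :=
  LinearMap.range (π (G.Se R e * G.St R e))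

/-- The data exhibiting a representation `π : L_R(𝒢) → Hom_R(N)` as permutative:
bases `B` of `N`, `B_v` of `N_v`, `B_{r(e)}` of `N_{r(e)}`, `B_e` of `N_e` with
`B_v, B_{r(e)} ⊆ B`, `B_v ⊆ B_{r(e)}` for `v ∈ r(e)`, `B_e ⊆ B_{s(e)}`, and
`π(s_e)(B_{r(e)}) = B_e`. -/
structure PermutativeData (π : LeavittAlgebra R G →ₐ[R] Module.End R N) where
  B : Set N
  Bv : V → Set N
  Br : E → Set N
  Be : E → Set N
  hB : LinearIndependent R ((↑) : B → N) ∧ Submodule.span R B = ⊤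
  hBv : ∀ v : V, IsBasisOf R (Bv v) (NvSub G R π v)
  hBr : ∀ e : E, IsBasisOf R (Br e) (NreSub G R π e)
  hBe : ∀ e : E, IsBasisOf R (Be e) (NeSub G R π e)
  hBvB : ∀ v : V, Bv v ⊆ B
  hBrB : ∀ e : E, Br e ⊆ B
  hBvBr : ∀ (e : E) (v : V), v ∈ G.r e → Bv v ⊆ Br e
  hBeBv : ∀ e : E, Be e ⊆ Bv (G.s e)
  hmap : ∀ e : E, (π (G.Se R e)) '' (Br e) = Be e

/-- A representation is permutative if such data exists. -/
def IsPermutative (π : LeavittAlgebra R G →ₐ[R] Module.End R N) : Prop :=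
  Nonempty (PermutativeData G R π)

end Representations

/-- A description of `A ∈ 𝒢⁰` as `(⋂_{e∈X₁} r(e)) ∪ ⋯ ∪ (⋂_{e∈Xₙ} r(e)) ∪ F`
with each `Xᵢ` a nonempty finite set of edges and `F` a finite set of vertices. -/
structure G0Desc (G : Ultragraph V E) (A : Set V) where
  n : ℕ
  Xs : Fin n → Finset E
  hXs : ∀ i, (Xs i).Nonempty
  F : Finset V
  eq : A = (⋃ i, ⋂ e ∈ (Xs i : Set E), G.r e) ∪ (F : Set V)

/-- The set `B_A` associated to a description of `A ∈ 𝒢⁰` and permutative data. -/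
def BAset {G : Ultragraph V E} (R : Type w) [CommRing R]
    {N : Type*} [AddCommGroup N] [Module R N]
    {π : LeavittAlgebra R G →ₐ[R] Module.End R N}
    (P : PermutativeData G R π) {A : Set V} (d : G0Desc G A) : Set N :=
  (⋃ i, ⋂ e ∈ (d.Xs i : Set E), P.Br e) ∪ ⋃ v ∈ (d.F : Set V), P.Bv v

end Ultragraph
namespace Ultragraph

variable {V : Type u} {E : Type v}

/-! ### Extreme vertices and the iterated construction `𝔾ₙ`, `Xₙ`, `Yₙ`, `Iₙ`

A sub-ultragraph is recorded as a pair `(W, Ed)` of a set of remaining vertices and a set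
of remaining edges; ranges are intersected with `W`. -/

/-- `e` is the extreme edge of the extreme vertex `A = r(e) ∩ W` of the sub-ultragraph
`(W, Ed)`: `r(e)` meets no other range and no source. -/
def IsExtremeRangeEdge (G : Ultragraph V E) (W : Set V) (Ed : Set E) (e : E) : Prop :=
  e ∈ Ed ∧ (∀ f ∈ Ed, f ≠ e → (G.r e ∩ W) ∩ (G.r f ∩ W) = ∅) ∧
    (∀ f ∈ Ed, G.s f ∉ G.r e ∩ W)

/-- `e` is the extreme edge of the extreme vertex `A = {s(e)}` of the sub-ultragraph
`(W, Ed)`: `s(e)` is the source of no other edge and lies in no range. -/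
def IsExtremeSourceEdge (G : Ultragraph V E) (W : Set V) (Ed : Set E) (e : E) : Prop :=
  e ∈ Ed ∧ G.s e ∈ W ∧ (∀ f ∈ Ed, f ≠ e → G.s f ≠ G.s e) ∧
    (∀ f ∈ Ed, G.s e ∉ G.r f ∩ W)

/-- The set of extreme vertices of the sub-ultragraph `(W, Ed)`. -/
def ExtremeVertSets (G : Ultragraph V E) (W : Set V) (Ed : Set E) : Set (Set V) :=
  {A | (∃ e, G.IsExtremeRangeEdge W Ed e ∧ A = G.r e ∩ W) ∨
    (∃ e, G.IsExtremeSourceEdge W Ed e ∧ A = {G.s e})}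

/-- The set of extreme edges of the sub-ultragraph `(W, Ed)`. -/
def ExtremeEdges (G : Ultragraph V E) (W : Set V) (Ed : Set E) : Set E :=
  {e | G.IsExtremeRangeEdge W Ed e ∨ G.IsExtremeSourceEdge W Ed e}

/-- The isolated vertices of the sub-ultragraph `(W, Ed)`: vertices of `W` lying in no
range and being no source. -/
def Isolated (G : Ultragraph V E) (W : Set V) (Ed : Set E) : Set V :=
  {v ∈ W | (∀ e ∈ Ed, v ∉ G.r e) ∧ (∀ e ∈ Ed, G.s e ≠ v)}

/-- `stage G n` is the sub-ultragraph `𝔾ₙ`; `stage G 0 = 𝔾₀` is obtained from `𝒢` by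
removing the isolated vertices, and `𝔾ₙ₊₁` is obtained from `𝔾ₙ` by removing the extreme
vertices `X̄ₙ₊₁`, the extreme edges `Yₙ₊₁`, and then the resulting isolated vertices
`Iₙ₊₁`. -/
def stage (G : Ultragraph V E) : ℕ → Set V × Set E
  | 0 => ({w | w ∈ (⋃ e : E, G.r e) ∪ Set.range G.s}, Set.univ)
  | n + 1 =>
      let p := stage G n
      let W' := p.1 \ ⋃₀ G.ExtremeVertSets p.1 p.2
      let Ed' := p.2 \ G.ExtremeEdges p.1 p.2
      (W' \ G.Isolated W' Ed', Ed')

/-- `XStep G n` is the set `Xₙ₊₁` of extreme vertices of `𝔾ₙ`. -/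
def XStep (G : Ultragraph V E) (n : ℕ) : Set (Set V) :=
  G.ExtremeVertSets (G.stage n).1 (G.stage n).2

/-- `XbarStep G n` is `X̄ₙ₊₁ = ⋃_{A ∈ Xₙ₊₁} A`. -/
def XbarStep (G : Ultragraph V E) (n : ℕ) : Set V := ⋃₀ G.XStep n

/-- `IStep G n` is the set `Iₙ₊₁` of isolated vertices of the ultragraph obtained from
`𝔾ₙ` by removing `X̄ₙ₊₁` and `Yₙ₊₁`. -/
def IStep (G : Ultragraph V E) (n : ℕ) : Set V :=
  G.Isolated ((G.stage n).1 \ G.XbarStep n)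
    ((G.stage n).2 \ G.ExtremeEdges (G.stage n).1 (G.stage n).2)

end Ultragraph

namespace Ultragraph

/-- The degree-weighted image of a generator in the group algebra of the free group over
`L_R(𝒢)`. -/
noncomputable def coactGen {V : Type u} {E : Type v} (G : Ultragraph V E) (R : Type w)
    [CommRing R] : LGen G → MonoidAlgebra (LeavittAlgebra R G) (FreeGroup E)
  | LGen.edge e => MonoidAlgebra.single (FreeGroup.of e) (G.Se R e)
  | LGen.ghost e => MonoidAlgebra.single (FreeGroup.of e)⁻¹ (G.St R e)
  | LGen.proj A => MonoidAlgebra.single 1 (G.Pg R A)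

/-- The quotient map, with values in `L_R(𝒢)`. -/
noncomputable def mkL {V : Type u} {E : Type v} (G : Ultragraph V E) (R : Type w) [CommRing R] :
    FreeAlgebra R (LGen G) →ₐ[R] LeavittAlgebra R G :=
  RingQuot.mkAlgHom R (LeavittRel R G)

theorem coact_rel {V : Type u} {E : Type v} (G : Ultragraph V E) (R : Type w) [CommRing R]
    ⦃x y : FreeAlgebra R (LGen G)⦄ (h : LeavittRel R G x y) :
    FreeAlgebra.lift R (G.coactGen R) x = FreeAlgebra.lift R (G.coactGen R) y := by
  have key : G.mkL R x = G.mkL R y := RingQuot.mkAlgHom_rel R h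
  have hE : ∀ e, G.mkL R (FreeAlgebra.ι R (LGen.edge e)) = G.Se R e := fun _ => rfl
  have hS : ∀ e, G.mkL R (FreeAlgebra.ι R (LGen.ghost e)) = G.St R e := fun _ => rfl
  have hP : ∀ A, G.mkL R (FreeAlgebra.ι R (LGen.proj A)) = G.Pg R A := fun _ => rfl
  cases h <;>
    simp only [map_mul, map_add, map_sub, map_zero, map_sum, FreeAlgebra.lift_ι_apply, hE, hS, hP]
      at key ⊢ <;>
    simp only [coactGen, MonoidAlgebra.single_mul_single, one_mul, mul_one, inv_mul_cancel,
      mul_inv_cancel, ← MonoidAlgebra.single_add, ← MonoidAlgebra.single_sub, key,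
      MonoidAlgebra.single_zero]
  exact map_sum (MonoidAlgebra.singleAddHom _) _ _

/-- The coaction `L_R(𝒢) → L_R(𝒢)[F]`. -/
noncomputable def coact {V : Type u} {E : Type v} (G : Ultragraph V E) (R : Type w)
    [CommRing R] :
    LeavittAlgebra R G →ₐ[R] MonoidAlgebra (LeavittAlgebra R G) (FreeGroup E) :=
  RingQuot.liftAlgHom R ⟨FreeAlgebra.lift R (G.coactGen R), G.coact_rel R⟩

theorem coact_mkL {V : Type u} {E : Type v} (G : Ultragraph V E) (R : Type w) [CommRing R]
    (x : FreeAlgebra R (LGen G)) :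
    G.coact R (G.mkL R x) = FreeAlgebra.lift R (G.coactGen R) x :=
  RingQuot.liftAlgHom_mkAlgHom_apply ..

/-- The homogeneous component of degree `t`. -/
noncomputable def comp {V : Type u} {E : Type v} (G : Ultragraph V E) (R : Type w)
    [CommRing R] (t : FreeGroup E) : Submodule R (LeavittAlgebra R G) :=
  LinearMap.eqLocus (G.coact R).toLinearMap (MonoidAlgebra.lsingle t)

theorem mem_comp {V : Type u} {E : Type v} (G : Ultragraph V E) (R : Type w)
    [CommRing R] (t : FreeGroup E) (x : LeavittAlgebra R G) :
    x ∈ G.comp R t ↔ G.coact R x = MonoidAlgebra.single t x := Iff.rfl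

theorem mul_mem_comp {V : Type u} {E : Type v} (G : Ultragraph V E) (R : Type w)
    [CommRing R] {g t : FreeGroup E} {a b : LeavittAlgebra R G} (ha : a ∈ G.comp R g)
    (hb : b ∈ G.comp R t) : a * b ∈ G.comp R (g * t) := by
  rw [mem_comp] at *
  rw [map_mul, ha, hb, MonoidAlgebra.single_mul_single]

theorem Pg_mem_comp {V : Type u} {E : Type v} (G : Ultragraph V E) (R : Type w)
    [CommRing R] (A : G.G0) : G.Pg R A ∈ G.comp R 1 :=
  (G.coact_mkL R _).trans (FreeAlgebra.lift_ι_apply ..)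

theorem Se_mem_comp {V : Type u} {E : Type v} (G : Ultragraph V E) (R : Type w)
    [CommRing R] (e : E) : G.Se R e ∈ G.comp R (FreeGroup.of e) :=
  (G.coact_mkL R _).trans (FreeAlgebra.lift_ι_apply ..)

theorem St_mem_comp {V : Type u} {E : Type v} (G : Ultragraph V E) (R : Type w)
    [CommRing R] (e : E) : G.St R e ∈ G.comp R (FreeGroup.of e)⁻¹ :=
  (G.coact_mkL R _).trans (FreeAlgebra.lift_ι_apply ..)

theorem iSupIndep_comp {V : Type u} {E : Type v} (G : Ultragraph V E) (R : Type w)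
    [CommRing R] : iSupIndep (G.comp R) := by
  intro i
  rw [Submodule.disjoint_def]
  intro x hx hx'
  let c : LeavittAlgebra R G →ₗ[R] LeavittAlgebra R G :=
    Finsupp.lapply i ∘ₗ (MonoidAlgebra.coeffLinearEquiv R).toLinearMap ∘ₗ (G.coact R).toLinearMap
  have hc : ∀ y, c y = (G.coact R y).coeff i := fun _ => rfl
  have hle : (⨆ j, ⨆ (_ : j ≠ i), G.comp R j) ≤ LinearMap.ker c := by
    refine iSup₂_le fun j hj y hy => ?_
    rw [mem_comp] at hy
    rw [LinearMap.mem_ker, hc, hy, MonoidAlgebra.coeff_single, Finsupp.single_eq_of_ne hj.symm]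
  have h0 := hle hx'
  rw [mem_comp] at hx
  rwa [LinearMap.mem_ker, hc, hx, MonoidAlgebra.coeff_single, Finsupp.single_eq_same] at h0

theorem iSup_comp {V : Type u} {E : Type v} (G : Ultragraph V E) (R : Type w)
    [CommRing R] : iSup (G.comp R) = ⊤ := by
  rw [eq_top_iff]
  rintro x -
  have hle := le_iSup (G.comp R)
  have hone : (1 : LeavittAlgebra R G) ∈ G.comp R 1 := by
    rw [mem_comp, map_one, MonoidAlgebra.one_def]
  have hmul : iSup (G.comp R) * iSup (G.comp R) ≤ iSup (G.comp R) := by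
    rw [Submodule.iSup_mul]
    refine iSup_le fun i => ?_
    rw [Submodule.mul_iSup]
    refine iSup_le fun j => Submodule.mul_le.2 fun a ha b hb => hle _ (G.mul_mem_comp R ha hb)
  obtain ⟨x, rfl⟩ : ∃ y, G.mkL R y = x := RingQuot.mkAlgHom_surjective R _ x
  induction x using FreeAlgebra.induction with
  | grade0 r =>
    rw [AlgHom.commutes, Algebra.algebraMap_eq_smul_one]
    exact Submodule.smul_mem _ _ (hle _ hone)
  | grade1 g =>
    cases g with
    | edge e => exact hle _ (G.Se_mem_comp R e)
    | ghost e => exact hle _ (G.St_mem_comp R e)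
    | proj A => exact hle _ (G.Pg_mem_comp R A)
  | mul a b ha hb =>
    rw [map_mul]
    exact hmul (Submodule.mul_mem_mul ha hb)
  | add a b ha hb =>
    rw [map_add]
    exact Submodule.add_mem _ ha hb

end Ultragraph

open Ultragraph in
/-- `L_R(𝒢)` is graded by the free group `F` on the edges: there is a family of
`R`-submodules `L_t` with `L_R(𝒢) = ⊕_{t ∈ F} L_t`, `L_s · L_t ⊆ L_{st}`, and
`p_A ∈ L_1`, `s_e ∈ L_e`, `s_e* ∈ L_{e⁻¹}`. -/
theorem leavittAlgebra_freeGroup_graded {V : Type u} {E : Type v} (G : Ultragraph V E)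
    (R : Type w) [CommRing R] [DecidableEq (FreeGroup E)] :
    ∃ Lc : FreeGroup E → Submodule R (LeavittAlgebra R G),
      DirectSum.IsInternal Lc ∧
      (∀ g t : FreeGroup E, ∀ a ∈ Lc g, ∀ b ∈ Lc t, a * b ∈ Lc (g * t)) ∧
      (∀ A : G.G0, G.Pg R A ∈ Lc 1) ∧
      (∀ e : E, G.Se R e ∈ Lc (FreeGroup.of e)) ∧
      (∀ e : E, G.St R e ∈ Lc (FreeGroup.of e)⁻¹) := by
  exact ⟨G.comp R,
    DirectSum.isInternal_submodule_of_iSupIndep_of_iSup_eq_top (G.iSupIndep_comp R)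
      (G.iSup_comp R),
    fun _ _ _ ha _ hb => G.mul_mem_comp R ha hb, G.Pg_mem_comp R, G.Se_mem_comp R,
    G.St_mem_comp R⟩
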